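/- Suppose Σ_C contains a concept name A and Σ_R contains a role name R. Then the concept ⊥ has no finite characterisation w.r.t. L(≥,⊥)[Σ_C,Σ_R]; in particular, L(≥,⊥) does not admit finite characterisations. -/

import Mathlib

namespace DL

/-! ### Syntax of ALCQI concepts -/

/-- Roles: role names (indexed by ℕ) and inverse roles. -/
inductive Role where
  | name : ℕ → Role
  | inv  : ℕ → Role
deriving DecidableEq

/-- ALCQI concept expressions. -/
inductive Concept where
  | atom : ℕ → Concept
  | top  : Concept
  | bot  : Concept
  | and  : Concept → Concept → Concept
  | or   : Concept → Concept → Concept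
  | neg  : Concept → Concept
  | ex   : Role → Concept → Concept
  | all  : Role → Concept → Concept
  | atLeast : ℕ → Role → Concept → Concept
deriving DecidableEq

/-- The operators/constructors that a concept language may use. -/
inductive Op where
  | all | ex | ge | inv | and | or | top | bot | neg
deriving DecidableEq

/-! ### Interpretations and semantics -/

/-- An interpretation: a nonempty domain, interpretations of concept names
and of role names. -/
structure Interp where
  Δ : Type
  dom_nonempty : Nonempty Δ
  atom : ℕ → Set Δ
  rel : ℕ → Δ → Δ → Prop

def Role.sem (I : Interp) : Role → (I.Δ → I.Δ → Prop)
  | .name R => I.rel R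
  | .inv R  => fun d e => I.rel R e d

def Concept.sem (I : Interp) : Concept → Set I.Δ
  | .atom A => I.atom A
  | .top => Set.univ
  | .bot => ∅
  | .and C D => C.sem I ∩ D.sem I
  | .or C D => C.sem I ∪ D.sem I
  | .neg C => (C.sem I)ᶜ
  | .ex S C => {d | ∃ e, S.sem I d e ∧ e ∈ C.sem I}
  | .all S C => {d | ∀ e, S.sem I d e → e ∈ C.sem I}
  | .atLeast k S C => {d | ∃ s : Finset I.Δ, s.card = k ∧ ∀ e ∈ s, S.sem I d e ∧ e ∈ C.sem I}

/-! ### Concept languages L(Os)[SC, SR] -/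

def Role.inSig (Os : Finset Op) (SR : Finset ℕ) : Role → Prop
  | .name R => R ∈ SR
  | .inv R  => Op.inv ∈ Os ∧ R ∈ SR

/-- Membership of a concept in the language `L(Os)[SC, SR]`. -/
def Concept.inLang (Os : Finset Op) (SC SR : Finset ℕ) : Concept → Prop
  | .atom A => A ∈ SC
  | .top => Op.top ∈ Os
  | .bot => Op.bot ∈ Os
  | .and C D => Op.and ∈ Os ∧ C.inLang Os SC SR ∧ D.inLang Os SC SR
  | .or C D => Op.or ∈ Os ∧ C.inLang Os SC SR ∧ D.inLang Os SC SR
  | .neg C => Op.neg ∈ Os ∧ C.inLang Os SC SR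
  | .ex S C => Op.ex ∈ Os ∧ S.inSig Os SR ∧ C.inLang Os SC SR
  | .all S C => Op.all ∈ Os ∧ S.inSig Os SR ∧ C.inLang Os SC SR
  | .atLeast k S C => Op.ge ∈ Os ∧ 1 ≤ k ∧ S.inSig Os SR ∧ C.inLang Os SC SR

/-! ### DL-Lite ontologies -/

/-- Basic concepts: concept names, ∃R and ∃R⁻. -/
inductive Basic where
  | atom : ℕ → Basic
  | ex : Role → Basic
deriving DecidableEq

def Basic.sem (I : Interp) : Basic → Set I.Δ
  | .atom A => I.atom A
  | .ex S => {d | ∃ e, S.sem I d e}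

/-- A DL-Lite concept inclusion `B ⊑ C` where `C` is a basic concept
(`negated = false`) or a negated basic concept (`negated = true`). -/
structure CI where
  lhs : Basic
  rhs : Basic
  negated : Bool
deriving DecidableEq

def CI.sat (I : Interp) (ci : CI) : Prop :=
  if ci.negated then ci.lhs.sem I ⊆ (ci.rhs.sem I)ᶜ else ci.lhs.sem I ⊆ ci.rhs.sem I

/-- A DL-Lite ontology: a finite set (list) of concept inclusions. -/
abbrev Ontology := List CI

def Interp.satO (I : Interp) (Ont : Ontology) : Prop := ∀ ci ∈ Ont, ci.sat I

/-! ### Pointed interpretations, examples, characterisations -/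

structure PInterp where
  I : Interp
  pt : I.Δ

/-- A pointed interpretation is finite if its domain is finite. -/
def PInterp.finite (P : PInterp) : Prop := Finite P.I.Δ

/-- `C` fits a collection `(Epos, Eneg)` of labelled examples. -/
def Fits (C : Concept) (Epos Eneg : List PInterp) : Prop :=
  (∀ e ∈ Epos, e.pt ∈ C.sem e.I) ∧ (∀ e ∈ Eneg, e.pt ∉ C.sem e.I)

/-- Equivalence of concepts. -/
def CEquiv (C D : Concept) : Prop := ∀ I : Interp, C.sem I = D.sem I

/-- Equivalence of concepts relative to an ontology. -/
def CEquivO (Ont : Ontology) (C D : Concept) : Prop :=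
  ∀ I : Interp, I.satO Ont → C.sem I = D.sem I

/-- `⊨ C ⊑ D`. -/
def Subsumes (C D : Concept) : Prop := ∀ I : Interp, C.sem I ⊆ D.sem I

/-- `Ont ⊨ C ⊑ D`. -/
def SubsumesO (Ont : Ontology) (C D : Concept) : Prop :=
  ∀ I : Interp, I.satO Ont → C.sem I ⊆ D.sem I

/-- `(Epos, Eneg)` is a finite characterisation of `C` w.r.t. the
concept language (predicate) `L`: all examples are finite, `C` fits,
and every fitting concept of `L` is equivalent to `C`. -/
def FinChar (L : Concept → Prop) (C : Concept) (Epos Eneg : List PInterp) : Prop :=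
  (∀ e ∈ Epos ++ Eneg, e.finite) ∧
  Fits C Epos Eneg ∧
  ∀ D, L D → Fits D Epos Eneg → CEquiv C D

/-- Finite characterisation of `C` w.r.t. `L` under an ontology `Ont`:
all examples are finite and satisfy `Ont`, `C` fits, and every fitting
concept of `L` is equivalent to `C` relative to `Ont`. -/
def FinCharO (Ont : Ontology) (L : Concept → Prop) (C : Concept)
    (Epos Eneg : List PInterp) : Prop :=
  (∀ e ∈ Epos ++ Eneg, e.finite ∧ e.I.satO Ont) ∧
  Fits C Epos Eneg ∧
  ∀ D, L D → Fits D Epos Eneg → CEquivO Ont C D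

/-- `L(Os)` admits finite characterisations. -/
def AdmitsFinChar (Os : Finset Op) : Prop :=
  ∀ SC SR : Finset ℕ, ∀ C : Concept, C.inLang Os SC SR →
    ∃ Epos Eneg : List PInterp, FinChar (Concept.inLang Os SC SR) C Epos Eneg

/-- `L(Os)` admits finite characterisations under the ontology `Ont`. -/
def AdmitsFinCharO (Os : Finset Op) (Ont : Ontology) : Prop :=
  ∀ SC SR : Finset ℕ, ∀ C : Concept, C.inLang Os SC SR →
    ∃ Epos Eneg : List PInterp, FinCharO Ont (Concept.inLang Os SC SR) C Epos Eneg

/-! ### Size, role depth, number restrictions -/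

/-- Number of symbols of a concept expression (numbers in binary). -/
def Concept.size : Concept → ℕ
  | .atom _ => 1
  | .top => 1
  | .bot => 1
  | .and C D => C.size + D.size + 1
  | .or C D => C.size + D.size + 1
  | .neg C => C.size + 1
  | .ex _ C => C.size + 2
  | .all _ C => C.size + 2
  | .atLeast k _ C => C.size + 2 + Nat.size k

/-- Role depth of a concept. -/
def Concept.dp : Concept → ℕ
  | .atom _ => 0
  | .top => 0
  | .bot => 0
  | .and C D => max C.dp D.dp
  | .or C D => max C.dp D.dp
  | .neg C => C.dp
  | .ex _ C => C.dp + 1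
  | .all _ C => C.dp + 1
  | .atLeast _ _ C => C.dp + 1

/-- The largest number occurring in a number restriction of `C` (0 if none). -/
def Concept.nr : Concept → ℕ
  | .atom _ => 0
  | .top => 0
  | .bot => 0
  | .and C D => max C.nr D.nr
  | .or C D => max C.nr D.nr
  | .neg C => C.nr
  | .ex _ C => C.nr
  | .all _ C => C.nr
  | .atLeast k _ C => max k C.nr

/-- The domain sizes of a finite list of pointed interpretations are bounded. -/
theorem exists_natCard_lt (E : List PInterp) : ∃ n : ℕ, ∀ e ∈ E, Nat.card e.I.Δ < n := by
  induction E with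
  | nil => exact ⟨0, by simp⟩
  | cons P E ih =>
    obtain ⟨n, hn⟩ := ih
    refine ⟨max n (Nat.card P.I.Δ + 1), fun e he => ?_⟩
    rcases List.mem_cons.1 he with rfl | he
    · omega
    · have := hn e he
      omega

/-- A number restriction exceeding the size of a finite domain has empty extension. -/
theorem notMem_sem_atLeast_of_card_lt (I : Interp) [Finite I.Δ] {n : ℕ}
    (h : Nat.card I.Δ < n) (S : Role) (C : Concept) (d : I.Δ) :
    d ∉ (Concept.atLeast n S C).sem I := by
  rintro ⟨s, hs, -⟩
  have hle := Set.ncard_le_card (s : Set I.Δ)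
  rw [Set.ncard_coe_finset] at hle
  omega

/-- The interpretation over `ℕ` in which every name holds everywhere. -/
def Interp.full : Interp where
  Δ := ℕ
  dom_nonempty := ⟨0⟩
  atom := fun _ => Set.univ
  rel := fun _ _ _ => True

theorem mem_sem_atLeast_full (n A R : ℕ) (d : Interp.full.Δ) :
    d ∈ (Concept.atLeast n (.name R) (.atom A)).sem Interp.full :=
  ⟨Finset.range n, Finset.card_range n, fun _ _ => ⟨trivial, trivial⟩⟩

/-- **Theorem**: if `A ∈ SC` and `R ∈ SR`, the concept `⊥` has no finite
characterisation w.r.t. `L(≥,⊥)[SC,SR]`; in particular `L(≥,⊥)` does not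
admit finite characterisations. -/
theorem no_finchar_ge_bot (SC SR : Finset ℕ) (A R : ℕ)
    (hA : A ∈ SC) (hR : R ∈ SR) :
    ¬ ∃ Epos Eneg : List PInterp,
      FinChar (Concept.inLang ({Op.ge, Op.bot} : Finset Op) SC SR)
        Concept.bot Epos Eneg := by
  rintro ⟨Epos, Eneg, hfin, ⟨hpos, -⟩, hchar⟩
  obtain ⟨n, hn⟩ := exists_natCard_lt Eneg
  have hfits : Fits (.atLeast (n + 1) (.name R) (.atom A)) Epos Eneg := by
    refine ⟨fun e he => (hpos e he).elim, fun e he => ?_⟩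
    have : Finite e.I.Δ := hfin e (List.mem_append_right _ he)
    exact notMem_sem_atLeast_of_card_lt e.I ((hn e he).trans n.lt_succ_self) _ _ _
  have hequiv := hchar (.atLeast (n + 1) (.name R) (.atom A)) ⟨by simp, n.succ_pos, hR, hA⟩
    hfits Interp.full
  have hmem := mem_sem_atLeast_full (n + 1) A R (0 : ℕ)
  rw [← hequiv] at hmem
  exact hmem

end DL
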